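/- Let S be a finite index set with strictly positive real weights (w_i)_{i∈S}, let A ⊆ S, fix an integer k with 1 ≤ k ≤ |A|, and regard the first-order inclusion probability π_i = w_i R(k−1, A∖{i}) / R(k, A) as a function of the weight vector w on the positive orthant. Then for i, j ∈ A: if j = i, ∂π_i/∂w_i = (π_i − π_i²)/w_i, and if j ≠ i, ∂π_i/∂w_j = (π_{i,j} − π_i π_j)/w_j (all quantities evaluated at the same weight vector). -/

import Mathlib

open Finset

/-- The R-function: `R(k, A) = ∑_{B ⊆ A, |B| = k} ∏_{i ∈ B} w i`, with
`R(0, A) = 1` and `R(k, A) = 0` for `k < 0` or `k > |A|`. -/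
noncomputable def Rfun {ι : Type*} [DecidableEq ι] (w : ι → ℝ) (k : ℤ) (A : Finset ι) : ℝ :=
  if k < 0 then 0 else ∑ B ∈ A.powersetCard k.toNat, ∏ i ∈ B, w i

/-- First-order inclusion probability `π_i = w_i R(k−1, A∖{i}) / R(k, A)`. -/
noncomputable def incl1 {ι : Type*} [DecidableEq ι] (w : ι → ℝ) (k : ℤ) (A : Finset ι)
    (i : ι) : ℝ :=
  w i * Rfun w (k - 1) (A.erase i) / Rfun w k A

/-- Second-order inclusion probability `π_{i,j} = w_i w_j R(k−2, A∖{i,j}) / R(k, A)`. -/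
noncomputable def incl2 {ι : Type*} [DecidableEq ι] (w : ι → ℝ) (k : ℤ) (A : Finset ι)
    (i j : ι) : ℝ :=
  w i * w j * Rfun w (k - 2) ((A.erase i).erase j) / Rfun w k A

theorem Rfun_pos {ι : Type*} [DecidableEq ι] {w : ι → ℝ} (hw : ∀ l, 0 < w l) {k : ℤ}
    {A : Finset ι} (hk : 0 ≤ k) (hkA : k ≤ (A.card : ℤ)) : 0 < Rfun w k A := by
  rw [Rfun, if_neg (by omega)]
  exact sum_pos (fun B _ => prod_pos fun l _ => hw l)
    (powersetCard_nonempty.2 (by omega))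

theorem Rfun_update_of_notMem {ι : Type*} [DecidableEq ι] (w : ι → ℝ) (k : ℤ) {A : Finset ι}
    {j : ι} (hj : j ∉ A) (t : ℝ) : Rfun (Function.update w j t) k A = Rfun w k A := by
  unfold Rfun
  congr 1
  refine sum_congr rfl fun B hB => prod_congr rfl fun l hl => ?_
  refine Function.update_of_ne ?_ _ _
  rintro rfl
  exact hj ((mem_powersetCard.1 hB).1 hl)

theorem Rfun_eq_erase_add {ι : Type*} [DecidableEq ι] (w : ι → ℝ) (k : ℤ) {A : Finset ι}
    {j : ι} (hj : j ∈ A) :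
    Rfun w k A = Rfun w k (A.erase j) + w j * Rfun w (k - 1) (A.erase j) := by
  rcases lt_trichotomy k 0 with hk | rfl | hk
  · simp [Rfun, hk, show k - 1 < 0 by omega]
  · simp [Rfun]
  · obtain ⟨n, rfl⟩ : ∃ n : ℕ, k = n + 1 := ⟨(k - 1).toNat, by omega⟩
    have hn : ((n : ℤ) + 1).toNat = n + 1 := by omega
    have hjA : j ∉ A.erase j := notMem_erase j A
    have hjB {B : Finset ι} (hB : B ∈ (A.erase j).powersetCard n) : j ∉ B :=
      fun h => hjA ((mem_powersetCard.1 hB).1 h)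
    rw [Rfun, Rfun, Rfun, if_neg (by omega), if_neg (by omega), if_neg (by omega), hn,
      add_sub_cancel_right, Int.toNat_natCast]
    conv_lhs => rw [← insert_erase hj]
    rw [powersetCard_succ_insert hjA, sum_union, sum_image, mul_sum]
    · congr 1
      exact sum_congr rfl fun B hB => prod_insert (hjB hB)
    · intro B hB C hC h
      rw [← erase_insert (hjB hB), h, erase_insert (hjB hC)]
    · rw [disjoint_left]
      intro B hB hB'
      obtain ⟨C, -, rfl⟩ := mem_image.1 hB'
      exact hjA ((mem_powersetCard.1 hB).1 (mem_insert_self j C))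

theorem hasDerivAt_Rfun_update {ι : Type*} [DecidableEq ι] (w : ι → ℝ) (k : ℤ) {A : Finset ι}
    {j : ι} (hj : j ∈ A) (x : ℝ) :
    HasDerivAt (fun t : ℝ => Rfun (Function.update w j t) k A)
      (Rfun w (k - 1) (A.erase j)) x := by
  have hR (t : ℝ) : Rfun (Function.update w j t) k A =
      Rfun w k (A.erase j) + t * Rfun w (k - 1) (A.erase j) := by
    have hjA := notMem_erase j A
    rw [Rfun_eq_erase_add _ k hj, Rfun_update_of_notMem w _ hjA, Rfun_update_of_notMem w _ hjA,
      Function.update_self]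
  simp only [hR]
  simpa using ((hasDerivAt_id x).mul_const (Rfun w (k - 1) (A.erase j))).const_add
    (Rfun w k (A.erase j))

/-- on the positive orthant, `∂π_i/∂w_i = (π_i − π_i²)/w_i` and, for `j ≠ i`,
`∂π_i/∂w_j = (π_{i,j} − π_i π_j)/w_j`. -/
theorem stmt_6 {ι : Type*} [DecidableEq ι] (A : Finset ι) (k : ℤ)
    (hk1 : 1 ≤ k) (hk2 : k ≤ (A.card : ℤ))
    (w : ι → ℝ) (hw : ∀ l, 0 < w l) (i j : ι) (hi : i ∈ A) (hj : j ∈ A) :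
    (j = i →
      HasDerivAt (fun t : ℝ => incl1 (Function.update w i t) k A i)
        ((incl1 w k A i - (incl1 w k A i) ^ 2) / w i) (w i)) ∧
    (j ≠ i →
      HasDerivAt (fun t : ℝ => incl1 (Function.update w j t) k A i)
        ((incl2 w k A i j - incl1 w k A i * incl1 w k A j) / w j) (w j)) := by
  have hR : Rfun w k A ≠ 0 := (Rfun_pos hw (by omega) hk2).ne'
  have hwj : w j ≠ 0 := (hw j).ne'
  have hden := hasDerivAt_Rfun_update w k hj (w j)
  have hupd : Rfun (Function.update w j (w j)) k A ≠ 0 := by rwa [Function.update_eq_self]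
  constructor
  · rintro rfl
    have hnum := (hasDerivAt_id (w j)).mul_const (Rfun w (k - 1) (A.erase j))
    simp only [incl1, Function.update_self, Rfun_update_of_notMem w _ (notMem_erase j A)]
    refine (hnum.fun_div hden hupd).congr_deriv ?_
    simp only [Function.update_eq_self, id]
    field_simp
  · intro hji
    have hnum := (hasDerivAt_Rfun_update w (k - 1) (mem_erase.2 ⟨hji, hj⟩) (w j)).const_mul
      (w i)
    simp only [incl1, incl2, Function.update_of_ne hji.symm]
    refine (hnum.fun_div hden hupd).congr_deriv ?_
    rw [Function.update_eq_self, show k - 1 - 1 = k - 2 by ring]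
    field_simp
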